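/- Let N=2 and Ω ⊂ R² be a bounded domain of class C^{2,β}. There exists p₀ > 1, depending on Ω, such that (1/p)Λ(Ω,2p) < λ₀(Ω,p) for all p > p₀. -/

import Mathlib

open MeasureTheory Metric Filter Real Set
noncomputable section

/-- The Rayleigh/Sobolev quotient. -/
def Ray {N : ℕ} (Ω : Set (EuclideanSpace ℝ (Fin N))) (q : ℝ)
    (w : EuclideanSpace ℝ (Fin N) → ℝ) : ℝ :=
  (∫ x in Ω, ‖gradient w x‖ ^ 2) / (∫ x in Ω, |w x| ^ q) ^ (2 / q)

/-- The best Sobolev constant `Λ(Ω,q)`. -/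
def Lam {N : ℕ} (Ω : Set (EuclideanSpace ℝ (Fin N))) (q : ℝ) : ℝ :=
  sInf {r | ∃ w, ContDiff ℝ (⊤ : ℕ∞) w ∧ HasCompactSupport w ∧ tsupport w ⊆ Ω ∧
    w ≠ 0 ∧ r = Ray Ω q w}

/-- `λ₀(Ω,p)`. -/
def lam0 (Ω : Set (EuclideanSpace ℝ (Fin 2))) (p : ℝ) : ℝ :=
  (8 * π / (p + 1)) ^ ((p - 1) / (2 * p)) * Lam Ω (p + 1) ^ ((p + 1) / (2 * p))

/-- The admissible functions `w` in the definition of `Lam Ω q`. -/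
def testFunctions {N : ℕ} (Ω : Set (EuclideanSpace ℝ (Fin N))) :
    Set (EuclideanSpace ℝ (Fin N) → ℝ) :=
  {w | ContDiff ℝ (⊤ : ℕ∞) w ∧ HasCompactSupport w ∧ tsupport w ⊆ Ω ∧ w ≠ 0}

section General

variable {N : ℕ} {Ω : Set (EuclideanSpace ℝ (Fin N))} {w : EuclideanSpace ℝ (Fin N) → ℝ}

lemma Lam_eq_sInf_image (q : ℝ) : Lam Ω q = sInf (Ray Ω q '' testFunctions Ω) := by
  unfold Lam testFunctions
  congr 1
  ext r
  simp only [mem_ofPred_eq, mem_image]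
  constructor
  · rintro ⟨w, h1, h2, h3, h4, rfl⟩
    exact ⟨w, ⟨h1, h2, h3, h4⟩, rfl⟩
  · rintro ⟨w, ⟨h1, h2, h3, h4⟩, rfl⟩
    exact ⟨w, h1, h2, h3, h4, rfl⟩

lemma Ray_nonneg (q : ℝ) : 0 ≤ Ray Ω q w := by
  unfold Ray
  positivity

lemma testFunctions_nonempty (hopen : IsOpen Ω) (hne : Ω.Nonempty) :
    (testFunctions Ω).Nonempty := by
  obtain ⟨x, hx⟩ := hne
  obtain ⟨f, h1, h2, h3, -, h5⟩ :=
    exists_contDiff_tsupport_subset (n := (⊤ : ℕ∞)) (hopen.mem_nhds hx)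
  exact ⟨f, h3, h2, h1, fun h => by simp [h] at h5⟩

lemma memLp_testFunction (hw : w ∈ testFunctions Ω) (q : ENNReal)
    (μ : Measure (EuclideanSpace ℝ (Fin N))) [IsFiniteMeasureOnCompacts μ] : MemLp w q μ :=
  hw.1.continuous.memLp_of_hasCompactSupport hw.2.1

lemma memLp_fderiv_testFunction (hw : w ∈ testFunctions Ω) (q : ENNReal)
    (μ : Measure (EuclideanSpace ℝ (Fin N))) [IsFiniteMeasureOnCompacts μ] :
    MemLp (fderiv ℝ w) q μ :=
  (hw.1.continuous_fderiv (by simp)).memLp_of_hasCompactSupport (hw.2.1.fderiv ℝ)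

lemma norm_gradient (x : EuclideanSpace ℝ (Fin N)) : ‖gradient w x‖ = ‖fderiv ℝ w x‖ := by
  simp [gradient]

lemma Ray_eq_lpNorm (hw : w ∈ testFunctions Ω) {q : ℝ} (hq : 0 < q) :
    Ray Ω q w = lpNorm (fderiv ℝ w) 2 (volume.restrict Ω) ^ 2 /
      lpNorm w (ENNReal.ofReal q) (volume.restrict Ω) ^ 2 := by
  have hi : 0 ≤ ∫ x in Ω, |w x| ^ q := integral_nonneg fun x => by positivity
  have hg : 0 ≤ ∫ x in Ω, ‖fderiv ℝ w x‖ ^ 2 := integral_nonneg fun x => by positivity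
  unfold Ray
  simp only [norm_gradient]
  rw [lpNorm_eq_integral_norm_rpow_toReal (by simp) (by simp)
      (memLp_fderiv_testFunction hw 2 _).aestronglyMeasurable,
    lpNorm_eq_integral_norm_rpow_toReal (by simpa using hq) (by simp)
      (memLp_testFunction hw 2 _).aestronglyMeasurable]
  simp only [ENNReal.toReal_ofReal hq.le, ENNReal.toReal_ofNat, rpow_ofNat, Real.norm_eq_abs]
  rw [← Real.rpow_mul_natCast hg, ← Real.rpow_mul_natCast hi]
  norm_num
  rw [inv_mul_eq_div]

lemma lpNorm_pos_of_testFunction (hopen : IsOpen Ω) (hw : w ∈ testFunctions Ω) {q : ENNReal}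
    (hq : q ≠ 0) : 0 < lpNorm w q (volume.restrict Ω) := by
  refine lt_of_le_of_ne lpNorm_nonneg fun h => hw.2.2.2 ?_
  rw [eq_comm, lpNorm_eq_zero (memLp_testFunction hw _ _) hq] at h
  have hon : EqOn w 0 Ω := Measure.eqOn_open_of_ae_eq h hopen hw.1.continuous.continuousOn
    continuousOn_const
  ext x
  by_cases hx : x ∈ Ω
  · exact hon hx
  · exact image_eq_zero_of_notMem_tsupport fun hx' => hx (hw.2.2.1 hx')

/-- `eLpNorm_restrict_eq_of_support_subset` for functions with values in a normed group; the
`ENorm` version is slow to unify for functions with values in spaces of linear maps. -/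
lemma eLpNorm_restrict_eq_of_support_subset_of_normed {α F : Type*} [MeasurableSpace α]
    [NormedAddCommGroup F] {μ : Measure α} {f : α → F} {s : Set α} {p : ENNReal}
    (h : f.support ⊆ s) : eLpNorm f p (μ.restrict s) = eLpNorm f p μ :=
  eLpNorm_restrict_eq_of_support_subset h

lemma lpNorm_le_lpNorm_mul_max {α F : Type*} [MeasurableSpace α] [NormedAddCommGroup F]
    {μ : Measure α} [IsFiniteMeasure μ] {f : α → F} {q r : ENNReal} (hq : 1 ≤ q) (hqr : q ≤ r)
    (hf : MemLp f r μ) :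
    lpNorm f q μ ≤ lpNorm f r μ * max 1 (μ.real univ) := by
  have h := eLpNorm_le_eLpNorm_mul_rpow_measure_univ hqr hf.1
  set s := 1 / q.toReal - 1 / r.toReal with hs
  have hs1 : s ≤ 1 := by
    have h1 : 1 / q.toReal ≤ 1 := by
      by_cases hqt : q = ⊤
      · simp [hqt]
      · have : 1 ≤ q.toReal := by simpa using ENNReal.toReal_mono hqt hq
        exact div_le_one_of_le₀ this (by positivity)
    have h2 : 0 ≤ 1 / r.toReal := by positivity
    linarith
  have hs0 : 0 ≤ s := by
    by_cases hrt : r = ⊤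
    · simp only [hs, hrt, ENNReal.toReal_top, div_zero, sub_zero]; positivity
    · have hqt : q ≠ ⊤ := ne_top_of_le_ne_top hrt hqr
      have h0 : 0 < q.toReal := ENNReal.toReal_pos (by positivity) hqt
      exact sub_nonneg.2 (one_div_le_one_div_of_le h0 (ENNReal.toReal_mono hrt hqr))
  have h' := ENNReal.toReal_mono
    (ENNReal.mul_ne_top hf.eLpNorm_ne_top (ENNReal.rpow_ne_top_of_nonneg hs0 (by simp))) h
  rw [ENNReal.toReal_mul, toReal_eLpNorm hf.1, toReal_eLpNorm hf.1, ← ENNReal.toReal_rpow] at h'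
  refine h'.trans (mul_le_mul_of_nonneg_left ?_ lpNorm_nonneg)
  calc (μ univ).toReal ^ s ≤ (max 1 (μ.real univ)) ^ s :=
        rpow_le_rpow (by positivity) (le_max_right _ _) hs0
    _ ≤ (max 1 (μ.real univ)) ^ (1 : ℝ) := rpow_le_rpow_of_exponent_le (le_max_left _ _) hs1
    _ = _ := rpow_one _

lemma Ray_le_mul_Ray (hopen : IsOpen Ω) (hbdd : Bornology.IsBounded Ω)
    (hw : w ∈ testFunctions Ω) {q r : ℝ} (hq : 1 ≤ q) (hqr : q ≤ r) :
    Ray Ω r w ≤ max 1 (volume.real Ω) ^ 2 * Ray Ω q w := by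
  have : Fact (volume Ω < ⊤) := ⟨hbdd.measure_lt_top⟩
  have hM : (volume.restrict Ω).real univ = volume.real Ω := by simp
  have h := lpNorm_le_lpNorm_mul_max (μ := volume.restrict Ω) (q := ENNReal.ofReal q)
    (r := ENNReal.ofReal r) (by simpa using hq) (ENNReal.ofReal_le_ofReal hqr)
    (memLp_testFunction hw _ _)
  rw [hM] at h
  have hq0 : 0 < q := by linarith
  have hr0 : 0 < r := by linarith
  have h1 := lpNorm_pos_of_testFunction hopen hw (q := ENNReal.ofReal q) (by simpa using hq0)
  have h2 := lpNorm_pos_of_testFunction hopen hw (q := ENNReal.ofReal r) (by simpa using hr0)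
  rw [Ray_eq_lpNorm hw hq0, Ray_eq_lpNorm hw hr0, ← mul_div_assoc,
    div_le_div_iff₀ (by positivity) (by positivity)]
  have h3 := pow_le_pow_left₀ h1.le h 2
  calc _ ≤ _ := mul_le_mul_of_nonneg_left h3 (sq_nonneg _)
    _ = _ := by ring

lemma Lam_le_mul_Lam (hopen : IsOpen Ω) (hne : Ω.Nonempty) (hbdd : Bornology.IsBounded Ω)
    {q r : ℝ} (hq : 1 ≤ q) (hqr : q ≤ r) :
    Lam Ω r ≤ max 1 (volume.real Ω) ^ 2 * Lam Ω q := by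
  have hM : 0 < max 1 (volume.real Ω) ^ 2 := by positivity
  rw [← div_le_iff₀' hM, Lam_eq_sInf_image, Lam_eq_sInf_image]
  refine le_csInf ((testFunctions_nonempty hopen hne).image _) ?_
  rintro _ ⟨w, hw, rfl⟩
  rw [div_le_iff₀' hM]
  refine (csInf_le ⟨0, ?_⟩ (mem_image_of_mem _ hw)).trans (Ray_le_mul_Ray hopen hbdd hw hq hqr)
  rintro _ ⟨v, -, rfl⟩
  exact Ray_nonneg r

end General

/-- The two-dimensional Gagliardo-Nirenberg-Sobolev inequality on a bounded set, for exponents with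
`1 / p ≤ 1 / 2 + 1 / q`. -/
lemma exists_eLpNorm_le_mul_eLpNorm_fderiv {Ω : Set (EuclideanSpace ℝ (Fin 2))}
    (hbdd : Bornology.IsBounded Ω) {p q : NNReal} (hp1 : 1 ≤ p) (hp2 : p < 2)
    (hpq : (p : ℝ)⁻¹ - 2⁻¹ ≤ (q : ℝ)⁻¹) :
    ∃ K : NNReal, ∀ u : EuclideanSpace ℝ (Fin 2) → ℝ, ContDiff ℝ 1 u → u.support ⊆ Ω →
      eLpNorm u q volume ≤ K * eLpNorm (fderiv ℝ u) p volume := by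
  have hn : Module.finrank ℝ (EuclideanSpace ℝ (Fin 2)) = 2 := finrank_euclideanSpace_fin
  have hp2' : p < Module.finrank ℝ (EuclideanSpace ℝ (Fin 2)) := by
    rw [hn]
    exact_mod_cast hp2
  have hpq' : (p⁻¹ : NNReal) - (Module.finrank ℝ (EuclideanSpace ℝ (Fin 2)) : ℝ)⁻¹ ≤
      (q : ℝ)⁻¹ := by
    rw [hn, NNReal.coe_inv]
    exact_mod_cast hpq
  exact ⟨_, fun u hu hsup => eLpNorm_le_eLpNorm_fderiv_of_le volume hu hsup hp1 hp2' hpq' hbdd⟩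

/-- The two-dimensional Sobolev inequality on a bounded open set. -/
lemma exists_lpNorm_le_mul_lpNorm_fderiv {Ω : Set (EuclideanSpace ℝ (Fin 2))}
    (hbdd : Bornology.IsBounded Ω) {q : ℝ} (hq : 2 ≤ q) :
    ∃ C : ℝ, 0 < C ∧ ∀ w ∈ testFunctions Ω,
      lpNorm w (ENNReal.ofReal q) (volume.restrict Ω) ≤
        C * lpNorm (fderiv ℝ w) 2 (volume.restrict Ω) := by
  have : Fact (volume Ω < ⊤) := ⟨hbdd.measure_lt_top⟩
  have hq0 : 0 < q := by linarith
  obtain ⟨p, hp⟩ : ∃ p : NNReal, (p : ℝ) = 2 * q / (q + 2) :=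
    ⟨_, Real.coe_toNNReal _ (by positivity)⟩
  have hp1 : 1 ≤ p := by
    rw [← NNReal.coe_le_coe, hp, NNReal.coe_one, le_div_iff₀ (by linarith)]
    linarith
  have hp2 : p < 2 := by
    rw [← NNReal.coe_lt_coe, hp, NNReal.coe_ofNat, div_lt_iff₀ (by linarith)]
    linarith
  obtain ⟨K, hK⟩ := exists_eLpNorm_le_mul_eLpNorm_fderiv hbdd (q := q.toNNReal) hp1 hp2 (by
    rw [hp, Real.coe_toNNReal _ hq0.le]
    refine le_of_eq ?_
    field_simp
    ring)
  refine ⟨(K + 1) * max 1 (volume.real Ω), by positivity, fun w hw => ?_⟩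
  have hsup : w.support ⊆ Ω := (subset_tsupport w).trans hw.2.2.1
  have hsup' : (fderiv ℝ w).support ⊆ Ω := (support_fderiv_subset ℝ).trans hw.2.2.1
  have hsob : eLpNorm w (ENNReal.ofReal q) volume ≤ K * eLpNorm (fderiv ℝ w) p volume :=
    hK w (hw.1.of_le (by simp)) hsup
  have hres : eLpNorm w (ENNReal.ofReal q) (volume.restrict Ω) =
      eLpNorm w (ENNReal.ofReal q) volume :=
    eLpNorm_restrict_eq_of_support_subset hsup
  have hres' : eLpNorm (fderiv ℝ w) p (volume.restrict Ω) = eLpNorm (fderiv ℝ w) p volume :=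
    eLpNorm_restrict_eq_of_support_subset_of_normed hsup'
  rw [← hres, ← hres'] at hsob
  have hd := memLp_fderiv_testFunction hw
  have hsob' := ENNReal.toReal_mono
    (ENNReal.mul_ne_top ENNReal.coe_ne_top (hd p (volume.restrict Ω)).eLpNorm_ne_top) hsob
  rw [ENNReal.toReal_mul, toReal_eLpNorm (hd p _).1,
    toReal_eLpNorm (memLp_testFunction hw 2 _).1, ENNReal.coe_toReal] at hsob'
  have hcomp := lpNorm_le_lpNorm_mul_max (μ := volume.restrict Ω) (q := (p : ENNReal)) (r := 2)
    (by exact_mod_cast hp1) (by exact_mod_cast hp2.le) (hd 2 _)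
  have hM : (volume.restrict Ω).real univ = volume.real Ω := by simp
  rw [hM] at hcomp
  calc lpNorm w (ENNReal.ofReal q) (volume.restrict Ω)
      ≤ K * lpNorm (fderiv ℝ w) p (volume.restrict Ω) := hsob'
    _ ≤ (K + 1) * lpNorm (fderiv ℝ w) p (volume.restrict Ω) :=
        mul_le_mul_of_nonneg_right (by linarith) lpNorm_nonneg
    _ ≤ (K + 1) * (lpNorm (fderiv ℝ w) 2 (volume.restrict Ω) * max 1 (volume.real Ω)) :=
        mul_le_mul_of_nonneg_left hcomp (by positivity)
    _ = _ := by ring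

lemma Lam_pos {Ω : Set (EuclideanSpace ℝ (Fin 2))} (hopen : IsOpen Ω) (hne : Ω.Nonempty)
    (hbdd : Bornology.IsBounded Ω) {q : ℝ} (hq : 2 ≤ q) : 0 < Lam Ω q := by
  obtain ⟨C, hC, h⟩ := exists_lpNorm_le_mul_lpNorm_fderiv hbdd hq
  have hq0 : 0 < q := by linarith
  have hC' : 0 < 1 / C ^ 2 := by positivity
  refine hC'.trans_le ?_
  rw [Lam_eq_sInf_image]
  refine le_csInf ((testFunctions_nonempty hopen hne).image _) ?_
  rintro _ ⟨w, hw, rfl⟩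
  have hpos := lpNorm_pos_of_testFunction hopen hw (q := ENNReal.ofReal q) (by simpa using hq0)
  rw [Ray_eq_lpNorm hw hq0, div_le_div_iff₀ (by positivity) (by positivity)]
  calc _ ≤ _ := mul_le_mul_of_nonneg_left (pow_le_pow_left₀ hpos.le (h w hw) 2) zero_le_one
    _ = _ := by ring

/-- Proposition 3.1: there exists `p₀ > 1`, depending on `Ω`, such that
`(1/p)Λ(Ω,2p) < λ₀(Ω,p)` for all `p > p₀`. -/
theorem statement6 (Ω : Set (EuclideanSpace ℝ (Fin 2)))
    (hopen : IsOpen Ω) (hconn : IsConnected Ω) (hbdd : Bornology.IsBounded Ω) :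
    ∃ p₀ : ℝ, 1 < p₀ ∧ ∀ p : ℝ, p₀ < p → Lam Ω (2 * p) / p < lam0 Ω p := by
  have hne := hconn.nonempty
  set A := max 1 (volume.real Ω) ^ 2 with hA
  have hA0 : 0 < A := by positivity
  set B := max 1 (A * Lam Ω 2) with hB
  have hB1 : 1 ≤ B := le_max_left _ _
  refine ⟨2 * (A * B) ^ 2 + 1, by linarith [show 0 < (A * B) ^ 2 by positivity], fun p hp => ?_⟩
  have hAB : 0 < (A * B) ^ 2 := by positivity
  have hp1 : 1 < p := by linarith
  have hp0 : 0 < p := by linarith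
  set L := Lam Ω (p + 1) with hL
  have hL0 : 0 < L := Lam_pos hopen hne hbdd (by linarith)
  have hLB : L ≤ B :=
    (Lam_le_mul_Lam hopen hne hbdd (by norm_num) (by linarith)).trans (le_max_right _ _)
  have hcomp : Lam Ω (2 * p) ≤ A * L :=
    Lam_le_mul_Lam hopen hne hbdd (by linarith) (by linarith)
  set s := (p - 1) / (2 * p) with hs
  have hs0 : 0 ≤ s := div_nonneg (by linarith) (by linarith)
  have hs1 : s ≤ 1 / 2 := by
    rw [hs, div_le_div_iff₀ (by positivity) (by norm_num)]
    linarith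
  have hs' : (p + 1) / (2 * p) = 1 - s := by
    rw [hs]
    field_simp
    ring
  have hLs : L ^ s ≤ B :=
    calc L ^ s ≤ B ^ s := rpow_le_rpow hL0.le hLB hs0
      _ ≤ B ^ (1 : ℝ) := rpow_le_rpow_of_exponent_le hB1 (by linarith)
      _ = B := rpow_one B
  have hroot : √(1 / (p + 1)) ≤ (8 * π / (p + 1)) ^ s :=
    calc √(1 / (p + 1)) = (1 / (p + 1)) ^ (1 / 2 : ℝ) := Real.sqrt_eq_rpow _
      _ ≤ (1 / (p + 1)) ^ s := rpow_le_rpow_of_exponent_ge (by positivity)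
          (div_le_one_of_le₀ (by linarith) (by linarith)) hs1
      _ ≤ _ := rpow_le_rpow (by positivity)
          (div_le_div_of_nonneg_right (by linarith [pi_gt_three]) (by linarith)) hs0
  have hsmall : A * B / p < √(1 / (p + 1)) := by
    refine Real.lt_sqrt_of_sq_lt ?_
    rw [div_pow, div_lt_div_iff₀ (by positivity) (by positivity)]
    nlinarith
  have hL1 : L = L ^ s * L ^ (1 - s) := by
    rw [← Real.rpow_add hL0]
    simp
  have hLpos : 0 < L ^ (1 - s) := by positivity
  rw [lam0, hs', ← hL, ← hs]
  calc Lam Ω (2 * p) / p ≤ A * L / p := div_le_div_of_nonneg_right hcomp hp0.le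
    _ = A * L ^ s / p * L ^ (1 - s) := by
        conv_lhs => rw [hL1]
        ring
    _ ≤ A * B / p * L ^ (1 - s) := by gcongr
    _ < (8 * π / (p + 1)) ^ s * L ^ (1 - s) :=
        mul_lt_mul_of_pos_right (hsmall.trans_le hroot) hLpos
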